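/- (Besicovitch–Calderón–Zygmund decomposition) Let μ be a non-atomic Borel measure on ℝ^n with μ(∂P) = 0 for every axis-parallel cube P, let Q be an axis-parallel cube with 0 < μ(Q) < ∞, let g ∈ L¹(Q, μ) be nonnegative, and let L > 0 satisfy ⨍_Q g dμ < L. Then there exists an at most countable family of axis-parallel cubes {Q_j} contained in Q such that: (i) ⨍_{Q_j} g dμ = L for each j; (ii) g(x) ≤ L for μ-almost every x ∈ Q \ ⋃_j Q_j; and (iii) the family {Q_j} can be written as a union of B(n) subfamilies F_1, …, F_{B(n)}, each consisting of pairwise disjoint cubes, where B(n) is a geometric constant depending only on n (the Besicovitch constant). In particular ∑_j μ(Q_j) ≤ B(n) · μ(Q) · (⨍_Q g dμ)/L. -/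

import Mathlib

open MeasureTheory Set Filter
open scoped ENNReal

/-- An axis-parallel cube of positive side length in `ℝⁿ`. -/
def IsCube (n : ℕ) (Q : Set (Fin n → ℝ)) : Prop :=
  ∃ (a : Fin n → ℝ) (h : ℝ), 0 < h ∧ Q = Set.univ.pi fun i => Set.Icc (a i) (a i + h)

/-- The closed cube with lower corner `z / 2 ^ k` and side `t / 2 ^ k`, where `c = (k, z)`. For
`t = 1` it is a dyadic cube, and for `t = 1 / 2` it is the lower child of that cube. -/
def cornerBox {n : ℕ} (c : ℕ × (Fin n → ℤ)) (t : ℝ) : Set (Fin n → ℝ) :=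
  {u | ∀ d, (c.2 d : ℝ) ≤ 2 ^ c.1 * u d ∧ 2 ^ c.1 * u d ≤ c.2 d + t}

theorem exists_recursive_function {V α : Type*} (r : V → ℕ)
    (Φ : (c : V) → ((s : V) → r s < r c → α) → α) :
    ∃ f : V → α, ∀ c, f c = Φ c fun s _ => f s :=
  ⟨(measure r).wf.fix Φ, fun _ => WellFounded.fix_eq _ _ _⟩

theorem exists_greedy_selection {V : Type*} (r : V → ℕ) (C : Set V) (R : V → V → Prop)
    (hR : ∀ c ∈ C, R c c) :
    ∃ S ⊆ C, (∀ c ∈ C, ∃ s ∈ S, R s c) ∧ ∀ s ∈ S, ∀ c ∈ S, r s < r c → ¬ R s c := by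
  obtain ⟨p, hp⟩ := exists_recursive_function r
    fun c (f : (s : V) → r s < r c → Prop) => c ∈ C ∧ ∀ s h, f s h → ¬ R s c
  refine ⟨{c | p c}, fun c hc => ?_, fun c hc => ?_, fun s hs c hc h => ?_⟩
  · rw [mem_ofPred_eq, hp] at hc
    exact hc.1
  · by_cases h : p c
    · exact ⟨c, h, hR c hc⟩
    · rw [hp] at h
      push Not at h
      obtain ⟨s, -, h1, h2⟩ := h hc
      exact ⟨s, h1, h2⟩
  · rw [mem_ofPred_eq, hp] at hc
    exact hc.2 s h hs

theorem exists_greedy_coloring {V α : Type*} [Nonempty α] (r : V → ℕ) (N : V → Set V)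
    (hN : ∀ c, ∀ f : V → α, ∃ a, ∀ s ∈ N c, f s ≠ a) (hr : ∀ c, ∀ s ∈ N c, r s < r c) :
    ∃ f : V → α, ∀ c, ∀ s ∈ N c, f s ≠ f c := by
  obtain ⟨f, hf⟩ := exists_recursive_function r
    fun c (f : (s : V) → r s < r c → α) =>
      Classical.epsilon fun a => ∀ s ∈ N c, ∀ h : r s < r c, f s h ≠ a
  refine ⟨f, fun c s hs => ?_⟩
  obtain ⟨a, ha⟩ := hN c f
  have key := Classical.epsilon_spec
    (p := fun a => ∀ s ∈ N c, ∀ h : r s < r c, f s ≠ a) ⟨a, fun s hs _ => ha s hs⟩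
  rw [hf c]
  exact key s hs (hr c s hs)

theorem floor_eq_of_mem_cornerBox {n : ℕ} {c : ℕ × (Fin n → ℤ)} {t : ℝ} (ht : t < 1)
    {u : Fin n → ℝ} (hu : u ∈ cornerBox c t) (d : Fin n) : ⌊(2 : ℝ) ^ c.1 * u d⌋ = c.2 d := by
  rw [Int.floor_eq_iff]
  exact ⟨(hu d).1, by linarith [(hu d).2]⟩

theorem eq_of_mem_cornerBox {n : ℕ} {c c' : ℕ × (Fin n → ℤ)} {t t' : ℝ} (ht : t < 1)
    (ht' : t' < 1) {u : Fin n → ℝ} (hu : u ∈ cornerBox c t) (hu' : u ∈ cornerBox c' t')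
    (h : c.1 = c'.1) : c = c' := by
  refine Prod.ext h (funext fun d => ?_)
  rw [← floor_eq_of_mem_cornerBox ht hu d, ← floor_eq_of_mem_cornerBox ht' hu' d, h]

theorem le_floor_of_pow_mul_le {k l : ℕ} (h : k ≤ l) {m : ℤ} {x : ℝ} (hm : (m : ℝ) ≤ 2 ^ k * x) :
    (m : ℝ) / 2 ^ k ≤ ⌊(2 : ℝ) ^ l * x⌋ / 2 ^ l := by
  obtain ⟨j, rfl⟩ := Nat.exists_eq_add_of_le h
  have h1 : m * 2 ^ j ≤ ⌊(2 : ℝ) ^ (k + j) * x⌋ := by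
    rw [Int.le_floor]
    push_cast
    calc (m : ℝ) * 2 ^ j ≤ (2 ^ k * x) * 2 ^ j := by gcongr
      _ = _ := by ring
  have h2 : ((m * 2 ^ j : ℤ) : ℝ) ≤ ⌊(2 : ℝ) ^ (k + j) * x⌋ := by exact_mod_cast h1
  rw [div_le_div_iff₀ (by positivity) (by positivity)]
  push_cast at h2
  calc (m : ℝ) * 2 ^ (k + j) = (m * 2 ^ j) * 2 ^ k := by ring
    _ ≤ _ := by gcongr

theorem floor_add_one_le_of_lt {k l : ℕ} (h : k ≤ l) {m : ℤ} {x : ℝ} (hm : 2 ^ k * x < (m : ℝ)) :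
    (⌊(2 : ℝ) ^ l * x⌋ + 1) / 2 ^ l ≤ (m : ℝ) / 2 ^ k := by
  obtain ⟨j, rfl⟩ := Nat.exists_eq_add_of_le h
  have h1 : ⌊(2 : ℝ) ^ (k + j) * x⌋ < m * 2 ^ j := by
    rw [Int.floor_lt]
    push_cast
    calc (2 : ℝ) ^ (k + j) * x = (2 ^ k * x) * 2 ^ j := by ring
      _ < _ := by gcongr
  have h2 : (⌊(2 : ℝ) ^ (k + j) * x⌋ : ℝ) + 1 ≤ ((m * 2 ^ j : ℤ) : ℝ) := by exact_mod_cast h1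
  rw [div_le_div_iff₀ (by positivity) (by positivity)]
  push_cast at h2
  calc _ ≤ ((m : ℝ) * 2 ^ j) * 2 ^ k := by gcongr
    _ = _ := by ring

/-- The upper face of the box of `c` normal to `d` is below the midpoint of the dyadic cube
of `c'`. -/
def FaceBelowMid {n : ℕ} (t : ℕ × (Fin n → ℤ) → ℝ) (c c' : ℕ × (Fin n → ℤ)) (d : Fin n) : Prop :=
  (c.2 d + t c) / 2 ^ c.1 < (c'.2 d + 1 / 2) / (2 : ℝ) ^ c'.1

theorem exists_faceBelowMid {n : ℕ} {t : ℕ × (Fin n → ℤ) → ℝ} {c c' : ℕ × (Fin n → ℤ)}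
    (ht' : t c' < 1) {v : Fin n → ℝ} (hv : v ∈ cornerBox c (t c)) (hv' : v ∈ cornerBox c' (t c'))
    (hlt : c.1 < c'.1) (hsub : ¬ cornerBox c' (1 / 2) ⊆ cornerBox c (t c)) :
    ∃ d, FaceBelowMid t c c' d := by
  by_contra! hcon
  refine hsub fun u hu d => ⟨?_, ?_⟩
  · have h1 := le_floor_of_pow_mul_le hlt.le (hv d).1
    rw [floor_eq_of_mem_cornerBox ht' hv' d] at h1
    have h2 : (c'.2 d : ℝ) / 2 ^ c'.1 ≤ u d := by
      rw [div_le_iff₀' (by positivity)]; exact (hu d).1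
    have h3 := h1.trans h2
    rwa [div_le_iff₀' (by positivity)] at h3
  · have h1 := hcon d
    rw [FaceBelowMid, not_lt] at h1
    have h2 : u d ≤ (c'.2 d + 1 / 2) / 2 ^ c'.1 := by
      rw [le_div_iff₀' (by positivity)]; exact (hu d).2
    have h3 := h2.trans h1
    rwa [le_div_iff₀' (by positivity)] at h3

theorem FaceBelowMid.not_trans {n : ℕ} {t : ℕ × (Fin n → ℤ) → ℝ} {c₁ c₂ c₃ : ℕ × (Fin n → ℤ)}
    {d : Fin n} (ht₂ : 1 / 2 ≤ t c₂) (ht₃ : t c₃ < 1) {v : Fin n → ℝ}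
    (hv₁ : v ∈ cornerBox c₁ (t c₁)) (hv₃ : v ∈ cornerBox c₃ (t c₃)) (hlt : c₂.1 < c₃.1)
    (h₁₂ : FaceBelowMid t c₁ c₂ d) : ¬ FaceBelowMid t c₂ c₃ d := by
  unfold FaceBelowMid at *
  have h1 : v d ≤ (c₁.2 d + t c₁) / 2 ^ c₁.1 := by
    rw [le_div_iff₀' (by positivity)]; exact (hv₁ d).2
  have h2 := h1.trans_lt h₁₂
  rw [lt_div_iff₀' (by positivity)] at h2
  have h3 : 2 ^ (c₂.1 + 1) * v d < ((2 * c₂.2 d + 1 : ℤ) : ℝ) := by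
    push_cast
    rw [pow_succ]
    linarith
  have h4 := floor_add_one_le_of_lt hlt h3
  rw [floor_eq_of_mem_cornerBox ht₃ hv₃ d] at h4
  rw [not_lt]
  calc (c₃.2 d + 1 / 2) / (2 : ℝ) ^ c₃.1 ≤ (c₃.2 d + 1) / (2 : ℝ) ^ c₃.1 := by gcongr; norm_num
    _ ≤ _ := h4
    _ = (c₂.2 d + 1 / 2) / 2 ^ c₂.1 := by push_cast; rw [pow_succ]; field_simp
    _ ≤ _ := by gcongr

theorem lowerCorner_mem_cornerBox {n : ℕ} {c c' : ℕ × (Fin n → ℤ)} {t t' : ℝ} (ht' : t' < 1)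
    (hle : c.1 ≤ c'.1) (h : (cornerBox c t ∩ cornerBox c' t').Nonempty) :
    (fun d => (c'.2 d : ℝ) / 2 ^ c'.1) ∈ cornerBox c t := by
  obtain ⟨u, hu, hu'⟩ := h
  intro d
  have h1 := le_floor_of_pow_mul_le hle (hu d).1
  rw [floor_eq_of_mem_cornerBox ht' hu' d] at h1
  refine ⟨by rwa [div_le_iff₀' (by positivity)] at h1, ?_⟩
  have h2 : (c'.2 d : ℝ) / 2 ^ c'.1 ≤ u d := by
    rw [div_le_iff₀' (by positivity)]; exact (hu' d).1
  exact le_trans (by gcongr) (hu d).2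

/-- Boxes with a common point whose lower halves are not covered by earlier boxes: there are
at most as many of them as sets of coordinates. -/
theorem injOn_setOf_faceBelowMid {n : ℕ} {t : ℕ × (Fin n → ℤ) → ℝ} {M : Set (ℕ × (Fin n → ℤ))}
    (ht : ∀ c ∈ M, 1 / 2 ≤ t c ∧ t c < 1) {v : Fin n → ℝ} (hv : ∀ c ∈ M, v ∈ cornerBox c (t c))
    (hsub : ∀ c ∈ M, ∀ c' ∈ M, c.1 < c'.1 → ¬ cornerBox c' (1 / 2) ⊆ cornerBox c (t c)) :
    InjOn (fun c => {d | ∃ c' ∈ M, c.1 < c'.1 ∧ FaceBelowMid t c c' d}) M := by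
  have key : ∀ c ∈ M, ∀ c' ∈ M, c.1 < c'.1 →
      {d | ∃ e ∈ M, c.1 < e.1 ∧ FaceBelowMid t c e d} ≠
        {d | ∃ e ∈ M, c'.1 < e.1 ∧ FaceBelowMid t c' e d} := by
    intro c hc c' hc' hlt heq
    obtain ⟨d, hd⟩ := exists_faceBelowMid (ht c' hc').2 (hv c hc) (hv c' hc') hlt
      (hsub c hc c' hc' hlt)
    have hmem : d ∈ {d | ∃ e ∈ M, c.1 < e.1 ∧ FaceBelowMid t c e d} := ⟨c', hc', hlt, hd⟩
    rw [heq] at hmem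
    obtain ⟨e, he, hlt', hd'⟩ := hmem
    exact hd.not_trans (ht c' hc').1 (ht e he).2 (hv c hc) (hv e he) hlt' hd'
  intro c hc c' hc' heq
  rcases lt_trichotomy c.1 c'.1 with h | h | h
  · exact (key c hc c' hc' h heq).elim
  · exact eq_of_mem_cornerBox (ht c hc).2 (ht c' hc').2 (hv c hc) (hv c' hc') h
  · exact (key c' hc' c hc h heq.symm).elim

theorem exists_cornerBox_selection {n : ℕ} (C : Set (ℕ × (Fin n → ℤ)))
    (t : ℕ × (Fin n → ℤ) → ℝ) (ht : ∀ c ∈ C, 1 / 2 ≤ t c ∧ t c < 1) :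
    ∃ S ⊆ C, (∀ c ∈ C, ∃ s ∈ S, cornerBox c (1 / 2) ⊆ cornerBox s (t s)) ∧
      ∃ col : ℕ × (Fin n → ℤ) → Set (Fin n), ∀ c ∈ S, ∀ c' ∈ S, c ≠ c' → col c = col c' →
        Disjoint (cornerBox c (t c)) (cornerBox c' (t c')) := by
  obtain ⟨S, hSC, hcov, hS⟩ := exists_greedy_selection Prod.fst C
    (fun s c => cornerBox c (1 / 2) ⊆ cornerBox s (t s))
    (fun c hc u hu d => ⟨(hu d).1, (hu d).2.trans (by linarith [(ht c hc).1])⟩)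
  refine ⟨S, hSC, hcov, ?_⟩
  have hN : ∀ c, ∀ f : ℕ × (Fin n → ℤ) → Set (Fin n), ∃ a,
      ∀ s ∈ {s | s ∈ S ∧ c ∈ S ∧ s.1 < c.1 ∧
      (cornerBox s (t s) ∩ cornerBox c (t c)).Nonempty}, f s ≠ a := by
    intro c f
    by_cases hc : c ∈ S
    swap
    · exact ⟨∅, fun s hs => (hc hs.2.1).elim⟩
    set N := {s | s ∈ S ∧ c ∈ S ∧ s.1 < c.1 ∧ (cornerBox s (t s) ∩ cornerBox c (t c)).Nonempty}
    have hNS : insert c N ⊆ S := insert_subset hc fun s hs => hs.1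
    have hv : ∀ s ∈ insert c N, (fun d => (c.2 d : ℝ) / 2 ^ c.1) ∈ cornerBox s (t s) := by
      intro s hs
      have hc0 : (fun d => (c.2 d : ℝ) / 2 ^ c.1) ∈ cornerBox c (t c) := fun d => by
        have h1 : (2 : ℝ) ^ c.1 * (c.2 d / 2 ^ c.1) = c.2 d := by field_simp
        simp only [h1]
        exact ⟨le_rfl, by linarith [(ht c (hSC hc)).1]⟩
      rcases hs with rfl | hs
      · exact hc0
      · exact lowerCorner_mem_cornerBox (ht c (hSC hc)).2 hs.2.2.1.le hs.2.2.2
    have hinj := injOn_setOf_faceBelowMid (fun s hs => ht s (hSC (hNS hs))) hv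
      fun s hs s' hs' => hS s (hNS hs) s' (hNS hs')
    have hfin : (insert c N).Finite := Set.Finite.of_injOn (mapsTo_univ _ _) hinj finite_univ
    have hcN : c ∉ N := fun h => lt_irrefl _ h.2.2.1
    by_contra! hcon
    have huniv : f '' N = univ := eq_univ_of_forall fun a => by
      obtain ⟨s, hs, h⟩ := hcon a
      exact ⟨s, hs, h⟩
    have hNfin : N.Finite := hfin.subset (subset_insert _ _)
    have h1 : (insert c N).ncard ≤ (univ : Set (Set (Fin n))).ncard :=
      ncard_le_ncard_of_injOn _ (fun _ _ => mem_univ _) hinj finite_univ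
    have h2 : (univ : Set (Set (Fin n))).ncard ≤ N.ncard := huniv ▸ ncard_image_le hNfin
    rw [ncard_insert_of_notMem hcN hNfin] at h1
    omega
  obtain ⟨col, hcol⟩ := exists_greedy_coloring Prod.fst _ hN fun c s hs => hs.2.2.1
  refine ⟨col, ?_⟩
  have key : ∀ c ∈ S, ∀ c' ∈ S, c.1 < c'.1 → col c = col c' →
      Disjoint (cornerBox c (t c)) (cornerBox c' (t c')) := by
    intro c hc c' hc' hlt heq
    by_contra hdis
    exact hcol c' c ⟨hc, hc', hlt, not_disjoint_iff_nonempty_inter.1 hdis⟩ heq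
  intro c hc c' hc' hne heq
  rcases lt_trichotomy c.1 c'.1 with h | h | h
  · exact key c hc c' hc' h heq
  · rw [Set.disjoint_left]
    exact fun u hu hu' =>
      hne (eq_of_mem_cornerBox (ht c (hSC hc)).2 (ht c' (hSC hc')).2 hu hu' h)
  · exact (key c' hc' c hc h heq.symm).symm

theorem measure_le_of_partitions {X ι : Type*} [TopologicalSpace X] [MeasurableSpace X]
    [OpensMeasurableSpace X] [Countable ι] {ν ρ : Measure X} [ν.OuterRegular] {C : ℝ≥0∞}
    (hC : C ≠ ∞) (hC0 : C ≠ 0)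
    {idx : ℕ → X → ι} (hmeas : ∀ k i, MeasurableSet (idx k ⁻¹' {i}))
    (hnested : ∀ k x y, idx (k + 1) x = idx (k + 1) y → idx k x = idx k y)
    (hsmall : ∀ x U, IsOpen U → x ∈ U → ∃ k, idx k ⁻¹' {idx k x} ⊆ U) {A : Set X}
    (hA : ∀ x ∈ A, ∀ k, ρ (idx k ⁻¹' {idx k x}) ≤ C * ν (idx k ⁻¹' {idx k x})) :
    ρ A ≤ C * ν A := by
  rw [← ENNReal.div_le_iff' hC0 hC]
  refine le_of_forall_gt_imp_ge_of_dense fun r hr => ?_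
  obtain ⟨U, hAU, hU, hUr⟩ := A.exists_isOpen_lt_of_lt r hr
  refine le_trans ?_ hUr.le
  rw [ENNReal.div_le_iff' hC0 hC]
  set s : ℕ → Set X := fun k => {x | x ∈ A ∧ idx k ⁻¹' {idx k x} ⊆ U}
  have hmono : Monotone s := monotone_nat_of_le_succ fun k x hx =>
    ⟨hx.1, fun y hy => hx.2 (hnested k y x hy)⟩
  have hcov : A ⊆ ⋃ k, s k := fun x hx => by
    obtain ⟨k, hk⟩ := hsmall x U hU (hAU hx)
    exact mem_iUnion.2 ⟨k, hx, hk⟩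
  refine (measure_mono hcov).trans ?_
  rw [hmono.measure_iUnion]
  refine iSup_le fun k => ?_
  have hdis : (idx k '' s k).PairwiseDisjoint fun i => idx k ⁻¹' {i} :=
    fun i _ j _ hij => Disjoint.preimage _ (by simpa using hij)
  calc ρ (s k) ≤ ρ (⋃ i ∈ idx k '' s k, idx k ⁻¹' {i}) :=
        measure_mono fun x hx => mem_biUnion (mem_image_of_mem _ hx) rfl
    _ = ∑' i : idx k '' s k, ρ (idx k ⁻¹' {(i : ι)}) :=
        measure_biUnion (to_countable _) hdis fun i _ => hmeas k i
    _ ≤ ∑' i : idx k '' s k, C * ν (idx k ⁻¹' {(i : ι)}) := by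
        refine ENNReal.tsum_le_tsum fun ⟨i, x, hx, hi⟩ => ?_
        subst hi
        exact hA x hx.1 k
    _ = C * ν (⋃ i ∈ idx k '' s k, idx k ⁻¹' {i}) := by
        rw [ENNReal.tsum_mul_left, measure_biUnion (to_countable _) hdis fun i _ => hmeas k i]
    _ ≤ C * ν U := by
        gcongr
        refine iUnion₂_subset ?_
        rintro _ ⟨x, hx, rfl⟩
        exact hx.2

theorem continuousOn_setIntegral_closedBall {E : Type*} [NormedAddCommGroup E] [NormedSpace ℝ E]
    [MeasurableSpace E] [OpensMeasurableSpace E] {μ : Measure E} {Q : Set E} {f : E → ℝ}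
    (hf : IntegrableOn f Q μ) {c : ℝ → E} {r : ℝ → ℝ} (hc : Continuous c) (hr : Continuous r)
    {s : Set ℝ} (hpos : ∀ t ∈ s, 0 < r t) (hsub : ∀ t ∈ s, Metric.closedBall (c t) (r t) ⊆ Q)
    (hnull : ∀ t ∈ s, μ (frontier (Metric.closedBall (c t) (r t))) = 0) :
    ContinuousOn (fun t => ∫ x in Metric.closedBall (c t) (r t), f x ∂μ) s := by
  have heq : ∀ t ∈ s, ∫ x in Metric.closedBall (c t) (r t), f x ∂μ =
      ∫ x in Q, (Metric.closedBall (c t) (r t)).indicator f x ∂μ := fun t ht => by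
    rw [setIntegral_indicator Metric.isClosed_closedBall.measurableSet,
      inter_eq_self_of_subset_right (hsub t ht)]
  refine ContinuousOn.congr (fun t₀ ht₀ => ?_) heq
  refine continuousWithinAt_of_dominated (bound := fun x => ‖f x‖)
    (Eventually.of_forall fun t =>
      hf.aestronglyMeasurable.indicator Metric.isClosed_closedBall.measurableSet)
    (Eventually.of_forall fun t => ae_of_all _ fun x => norm_indicator_le_norm_self _ _)
    hf.norm ?_
  have h0 := hnull t₀ ht₀
  rw [frontier_closedBall _ (hpos t₀ ht₀).ne'] at h0
  have h1 : ∀ᵐ x ∂μ.restrict Q, x ∉ Metric.sphere (c t₀) (r t₀) :=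
    ae_restrict_of_ae (measure_eq_zero_iff_ae_notMem.1 h0)
  filter_upwards [h1] with x hx
  refine ContinuousAt.continuousWithinAt ?_
  have hd : Continuous fun t => dist x (c t) := continuous_const.dist hc
  rcases lt_or_gt_of_ne (show dist x (c t₀) ≠ r t₀ from hx) with h | h
  · refine (continuousAt_const (y := f x)).congr ?_
    filter_upwards [hd.continuousAt.eventually_lt hr.continuousAt h] with t ht
    rw [indicator_of_mem (show x ∈ Metric.closedBall (c t) (r t) from ht.le)]
  · refine (continuousAt_const (y := (0 : ℝ))).congr ?_
    filter_upwards [hr.continuousAt.eventually_lt hd.continuousAt h] with t ht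
    rw [indicator_of_notMem (show x ∉ Metric.closedBall (c t) (r t) from fun h => ht.not_ge h)]

theorem isCube_closedBall {n : ℕ} (c : Fin n → ℝ) {r : ℝ} (hr : 0 < r) :
    IsCube n (Metric.closedBall c r) := by
  refine ⟨fun i => c i - r, 2 * r, by positivity, ?_⟩
  rw [closedBall_pi _ hr.le]
  congr 1
  ext i : 1
  rw [Real.closedBall_eq_Icc]
  congr 1
  ring

/-- Affine coordinates in which the cube with lower corner `a` and side `h` is the unit cube, the
orientation of the coordinates in `σ` being reversed. -/
noncomputable def cornerMap {n : ℕ} (a : Fin n → ℝ) (h : ℝ) (σ : Fin n → Bool) (x : Fin n → ℝ) :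
    Fin n → ℝ :=
  fun d => if σ d then (a d + h - x d) / h else (x d - a d) / h

/-- The cube `cornerBox c t` in the coordinates `cornerMap a h σ`. -/
def cornerCube {n : ℕ} (a : Fin n → ℝ) (h : ℝ) (σ : Fin n → Bool) (c : ℕ × (Fin n → ℤ)) (t : ℝ) :
    Set (Fin n → ℝ) :=
  cornerMap a h σ ⁻¹' cornerBox c t

/-- The center of `cornerCube a h σ c t`. -/
noncomputable def cornerCenter {n : ℕ} (a : Fin n → ℝ) (h : ℝ) (σ : Fin n → Bool)
    (c : ℕ × (Fin n → ℤ)) (t : ℝ) : Fin n → ℝ :=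
  fun d => if σ d then a d + h - h / 2 ^ c.1 * (c.2 d + t / 2) else
    a d + h / 2 ^ c.1 * (c.2 d + t / 2)

section cornerCube

variable {n : ℕ} {a : Fin n → ℝ} {h : ℝ} {σ : Fin n → Bool} {c : ℕ × (Fin n → ℤ)} {t : ℝ}

theorem dist_cornerCenter (hh : 0 < h) (x : Fin n → ℝ) (d : Fin n) :
    dist (x d) (cornerCenter a h σ c t d) =
      h / 2 ^ c.1 * |2 ^ c.1 * cornerMap a h σ x d - (c.2 d + t / 2)| := by
  have hp : 0 < h / 2 ^ c.1 := by positivity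
  rw [Real.dist_eq, ← abs_of_pos hp, ← abs_mul]
  unfold cornerCenter cornerMap
  split_ifs
  · rw [← abs_neg]
    congr 1
    field_simp
    ring
  · congr 1
    field_simp
    ring

theorem cornerCube_eq_closedBall (hh : 0 < h) (ht : 0 < t) :
    cornerCube a h σ c t = Metric.closedBall (cornerCenter a h σ c t) (h / 2 ^ c.1 * (t / 2)) := by
  have hp : 0 < h / 2 ^ c.1 := by positivity
  ext x
  rw [Metric.mem_closedBall, dist_pi_le_iff (by positivity)]
  refine forall_congr' fun d => ?_
  rw [dist_cornerCenter hh, mul_le_mul_iff_right₀ hp, abs_le]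
  constructor <;> rintro ⟨h1, h2⟩ <;> constructor <;> linarith

theorem lt_of_mem_interior_cornerCube (hh : 0 < h) (ht : 0 < t) {x : Fin n → ℝ}
    (hx : x ∈ interior (cornerCube a h σ c t)) (d : Fin n) :
    2 ^ c.1 * cornerMap a h σ x d < c.2 d + t := by
  have hp : 0 < h / 2 ^ c.1 := by positivity
  rw [cornerCube_eq_closedBall hh ht, interior_closedBall _ (by positivity), Metric.mem_ball,
    dist_pi_lt_iff (by positivity)] at hx
  have := hx d
  rw [dist_cornerCenter hh, mul_lt_mul_iff_right₀ hp, abs_lt] at this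
  linarith

theorem isCube_cornerCube (hh : 0 < h) (ht : 0 < t) : IsCube n (cornerCube a h σ c t) := by
  rw [cornerCube_eq_closedBall hh ht]
  exact isCube_closedBall _ (by positivity)

theorem measurableSet_cornerCube (hh : 0 < h) (ht : 0 < t) :
    MeasurableSet (cornerCube a h σ c t) := by
  rw [cornerCube_eq_closedBall hh ht]
  exact Metric.isClosed_closedBall.measurableSet

theorem cornerCube_mono {t' : ℝ} (htt : t ≤ t') :
    cornerCube a h σ c t ⊆ cornerCube a h σ c t' :=
  fun _ hx d => ⟨(hx d).1, (hx d).2.trans (by gcongr)⟩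

theorem cornerCube_zero_one (hh : 0 < h) :
    cornerCube a h σ 0 1 = univ.pi fun i => Icc (a i) (a i + h) := by
  ext x
  simp only [cornerCube, mem_preimage, cornerBox, mem_ofPred_eq, mem_univ_pi, mem_Icc]
  refine forall_congr' fun d => ?_
  simp only [cornerMap, Prod.fst_zero, Prod.snd_zero, Pi.zero_apply]
  split_ifs <;> simp [div_le_iff₀ hh, le_div_iff₀ hh]
  · constructor <;> rintro ⟨h1, h2⟩ <;> constructor <;> linarith
  · rintro -
    constructor <;> intro <;> linarith

theorem cornerMap_eq (hh : 0 < h) (x : Fin n → ℝ) (d : Fin n) :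
    cornerMap a h σ x d = if σ d then 1 - cornerMap a h (fun _ => false) x d else
      cornerMap a h (fun _ => false) x d := by
  simp only [cornerMap, Bool.false_eq_true, if_false]
  split_ifs
  · field_simp
    ring
  · rfl

theorem exists_setIntegral_cornerCube_eq_zero (hh : 0 < h) {μ : Measure (Fin n → ℝ)}
    (hμ : ∀ P : Set (Fin n → ℝ), IsCube n P → μ (frontier P) = 0) {f : (Fin n → ℝ) → ℝ}
    (hf : IntegrableOn f (cornerCube a h σ c 1) μ)
    (h₁ : ∫ x in cornerCube a h σ c 1, f x ∂μ < 0)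
    (h₂ : 0 ≤ ∫ x in cornerCube a h σ c (1 / 2), f x ∂μ) :
    ∃ t, 1 / 2 ≤ t ∧ t < 1 ∧ ∫ x in cornerCube a h σ c t, f x ∂μ = 0 := by
  have hpos : ∀ t ∈ Icc (1 / 2 : ℝ) 1, 0 < t := fun t ht => by linarith [ht.1]
  have hcont : ContinuousOn (fun t => ∫ x in cornerCube a h σ c t, f x ∂μ) (Icc (1 / 2) 1) := by
    refine ContinuousOn.congr (continuousOn_setIntegral_closedBall (s := Icc (1 / 2) 1) hf
      (c := cornerCenter a h σ c) (r := fun t => h / 2 ^ c.1 * (t / 2)) ?_ (by fun_prop) ?_ ?_ ?_)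
      fun t ht => by simp only [cornerCube_eq_closedBall hh (hpos t ht)]
    · refine continuous_pi fun d => ?_
      unfold cornerCenter
      split_ifs <;> fun_prop
    · intro t ht
      have := hpos t ht
      positivity
    · intro t ht
      rw [← cornerCube_eq_closedBall hh (hpos t ht)]
      exact cornerCube_mono ht.2
    · intro t ht
      rw [← cornerCube_eq_closedBall hh (hpos t ht)]
      exact hμ _ (isCube_cornerCube hh (hpos t ht))
  obtain ⟨t, ht, h0⟩ := intermediate_value_Icc' (by norm_num) hcont ⟨h₁.le, h₂⟩
  refine ⟨t, ht.1, lt_of_le_of_ne ht.2 ?_, h0⟩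
  rintro rfl
  exact h₁.ne h0

end cornerCube

theorem ofReal_setIntegral {X : Type*} [MeasurableSpace X] {μ : Measure X} {g : X → ℝ}
    (hg : ∀ x, 0 ≤ g x) {S : Set X} (hS : IntegrableOn g S μ) :
    ∫⁻ x in S, ENNReal.ofReal (g x) ∂μ = ENNReal.ofReal (∫ x in S, g x ∂μ) :=
  (ofReal_integral_eq_lintegral_ofReal hS (ae_of_all _ hg)).symm

/-- The index of the dyadic subcube of generation `k` containing `x`. -/
noncomputable def dyadicIndex {n : ℕ} (a : Fin n → ℝ) (h : ℝ) (k : ℕ) (x : Fin n → ℝ) :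
    Fin n → ℤ :=
  fun d => ⌊2 ^ k * cornerMap a h (fun _ => false) x d⌋

/-- The dyadic subcubes of the cube with lower corner `a` and side `h`. -/
def dyadicCube {n : ℕ} (a : Fin n → ℝ) (h : ℝ) (k : ℕ) (z : Fin n → ℤ) : Set (Fin n → ℝ) :=
  cornerCube a h (fun _ => false) (k, z) 1

section dyadicCube

variable {n : ℕ} {a : Fin n → ℝ} {h : ℝ} {k : ℕ}

theorem preimage_dyadicIndex_subset (z : Fin n → ℤ) :
    dyadicIndex a h k ⁻¹' {z} ⊆ dyadicCube a h k z := by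
  rintro x rfl d
  exact ⟨Int.floor_le _, (Int.lt_floor_add_one _).le⟩

theorem mem_dyadicCube_dyadicIndex (x : Fin n → ℝ) :
    x ∈ dyadicCube a h k (dyadicIndex a h k x) :=
  preimage_dyadicIndex_subset _ rfl

theorem interior_dyadicCube_subset (hh : 0 < h) (z : Fin n → ℤ) :
    interior (dyadicCube a h k z) ⊆ dyadicIndex a h k ⁻¹' {z} := fun _ hx =>
  funext fun d => Int.floor_eq_iff.2
    ⟨(interior_subset hx d).1, lt_of_mem_interior_cornerCube hh one_pos hx d⟩

theorem dyadicIndex_succ_ediv_two (x : Fin n → ℝ) (d : Fin n) :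
    dyadicIndex a h (k + 1) x d / 2 = dyadicIndex a h k x d := by
  have := Int.floor_div_natCast (2 ^ (k + 1) * cornerMap a h (fun _ => false) x d) 2
  unfold dyadicIndex
  push_cast at this
  rw [← this]
  congr 1
  rw [pow_succ]
  ring

theorem measurableSet_preimage_dyadicIndex (z : Fin n → ℤ) :
    MeasurableSet (dyadicIndex a h k ⁻¹' {z}) := by
  refine measurable_pi_lambda _ (fun d => ?_) (measurableSet_singleton z)
  simp only [dyadicIndex, cornerMap, Bool.false_eq_true, if_false]
  refine Int.measurable_floor.comp ?_
  fun_prop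

theorem exists_preimage_dyadicIndex_subset (hh : 0 < h) {x : Fin n → ℝ} {U : Set (Fin n → ℝ)}
    (hU : IsOpen U) (hx : x ∈ U) :
    ∃ k, dyadicIndex a h k ⁻¹' {dyadicIndex a h k x} ⊆ U := by
  obtain ⟨ε, hε, hball⟩ := Metric.isOpen_iff.1 hU x hx
  obtain ⟨k, hk⟩ := exists_pow_lt_of_lt_one (div_pos hε hh) (show (1 / 2 : ℝ) < 1 by norm_num)
  refine ⟨k, fun y hy => hball ?_⟩
  have h1 := preimage_dyadicIndex_subset _ hy
  have h2 : x ∈ dyadicCube a h k (dyadicIndex a h k x) := mem_dyadicCube_dyadicIndex x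
  rw [dyadicCube, cornerCube_eq_closedBall hh one_pos] at h1 h2
  rw [Metric.mem_ball]
  refine (dist_triangle_right _ _ _).trans_lt ((add_le_add h1 h2).trans_lt ?_)
  rw [lt_div_iff₀ hh, one_div, inv_pow] at hk
  calc _ = (2 ^ k)⁻¹ * h := by ring
    _ < ε := hk

theorem dyadicCube_zero (hh : 0 < h) :
    dyadicCube a h 0 0 = univ.pi fun i => Icc (a i) (a i + h) :=
  cornerCube_zero_one hh

theorem dyadicCube_subset {z : Fin n → ℤ} (hz : ∀ d, 0 ≤ z d ∧ z d < 2 ^ k) :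
    dyadicCube a h k z ⊆ dyadicCube a h 0 0 := by
  intro x hx d
  have hp : (0 : ℝ) < 2 ^ k := by positivity
  have h0 : (0 : ℝ) ≤ z d := by exact_mod_cast (hz d).1
  have h1 : (z d : ℝ) + 1 ≤ 2 ^ k := by exact_mod_cast (hz d).2
  have h2 := hx d
  simp only [pow_zero, one_mul, Pi.zero_apply, Int.cast_zero, zero_add] at h2 ⊢
  constructor
  · by_contra! hneg
    have := mul_neg_of_pos_of_neg hp hneg
    linarith
  · by_contra! hgt
    have := mul_lt_mul_of_pos_left hgt hp
    linarith

theorem ae_le_of_setIntegral_dyadicCube_le (hh : 0 < h) {μ : Measure (Fin n → ℝ)}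
    (hμ : ∀ P : Set (Fin n → ℝ), IsCube n P → μ (frontier P) = 0)
    (hfin : μ (dyadicCube a h 0 0) ≠ ∞) {g : (Fin n → ℝ) → ℝ} (hg : ∀ x, 0 ≤ g x)
    (hint : IntegrableOn g (dyadicCube a h 0 0) μ) {L : ℝ} (hL : 0 < L) {E : Set (Fin n → ℝ)}
    (hE : MeasurableSet E) (hEQ : E ⊆ dyadicCube a h 0 0)
    (hsub : ∀ x ∈ E, ∀ k, dyadicCube a h k (dyadicIndex a h k x) ⊆ dyadicCube a h 0 0)
    (hle : ∀ x ∈ E, ∀ k, ∫ y in dyadicCube a h k (dyadicIndex a h k x), g y ∂μ ≤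
      L * μ.real (dyadicCube a h k (dyadicIndex a h k x))) :
    ∀ᵐ x ∂μ.restrict E, g x ≤ L := by
  set Q := dyadicCube a h 0 0
  have : IsFiniteMeasure (μ.restrict Q) := ⟨by simpa using hfin.lt_top⟩
  set ρ := (μ.restrict Q).withDensity fun x => ENNReal.ofReal (g x) with hρ
  have hmeas : ∀ k z, MeasurableSet (dyadicCube a h k z) :=
    fun k z => measurableSet_cornerCube hh one_pos
  have hLpos : ENNReal.ofReal L ≠ 0 := by simpa using hL
  have key : ∀ A ⊆ E, ρ A ≤ ENNReal.ofReal L * (μ.restrict Q) A := by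
    intro A hA
    refine measure_le_of_partitions (idx := dyadicIndex a h) ENNReal.ofReal_ne_top hLpos
      (fun k z => measurableSet_preimage_dyadicIndex z)
      (fun k x y hxy => funext fun d => by
        rw [← dyadicIndex_succ_ediv_two x, ← dyadicIndex_succ_ediv_two y, hxy])
      (fun x U hU hx => exists_preimage_dyadicIndex_subset hh hU hx) fun x hx k => ?_
    set P := dyadicCube a h k (dyadicIndex a h k x)
    have hPQ : P ⊆ Q := hsub x (hA hx) k
    have hPfin : μ P ≠ ∞ := measure_ne_top_of_subset hPQ hfin
    calc ρ (dyadicIndex a h k ⁻¹' {dyadicIndex a h k x}) ≤ ρ P :=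
          measure_mono (preimage_dyadicIndex_subset _)
      _ = ∫⁻ y in P, ENNReal.ofReal (g y) ∂μ := by
          rw [hρ, withDensity_apply _ (hmeas _ _), Measure.restrict_restrict (hmeas _ _),
            inter_eq_self_of_subset_left hPQ]
      _ = ENNReal.ofReal (∫ y in P, g y ∂μ) := ofReal_setIntegral hg (hint.mono_set hPQ)
      _ ≤ ENNReal.ofReal (L * μ.real P) := ENNReal.ofReal_le_ofReal (hle x (hA hx) k)
      _ = ENNReal.ofReal L * μ P := by
          rw [ENNReal.ofReal_mul hL.le, ofReal_measureReal hPfin]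
      _ = ENNReal.ofReal L * (μ.restrict Q) (interior P) := by
          rw [Measure.restrict_apply isOpen_interior.measurableSet,
            inter_eq_self_of_subset_left (interior_subset.trans hPQ),
            measure_interior_of_null_frontier (hμ P (isCube_cornerCube hh one_pos))]
      _ ≤ _ := by
          gcongr
          exact interior_dyadicCube_subset hh _
  have hres : μ.restrict E = (μ.restrict Q).restrict E := by
    rw [Measure.restrict_restrict hE, inter_eq_self_of_subset_left hEQ]
  have hae : (fun x => ENNReal.ofReal (g x)) ≤ᵐ[μ.restrict E] fun _ => ENNReal.ofReal L := by
    rw [hres]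
    refine ae_le_of_forall_setLIntegral_le_of_sigmaFinite₀
      (hint.aestronglyMeasurable.aemeasurable.ennreal_ofReal.restrict) fun s hs _ => ?_
    rw [setLIntegral_const, Measure.restrict_apply hs, Measure.restrict_restrict hs,
      ← withDensity_apply _ (hs.inter hE)]
    exact key _ inter_subset_right
  filter_upwards [hae] with x hx
  exact (ENNReal.ofReal_le_ofReal_iff hL.le).1 hx

/-- Every dyadic cube is the lower child of its parent in suitably reversed coordinates. -/
theorem exists_cornerCube_eq_dyadicCube (hh : 0 < h) (k : ℕ) (w : Fin n → ℤ) :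
    ∃ (σ : Fin n → Bool) (z : Fin n → ℤ),
      cornerCube a h σ (k, z) 1 = dyadicCube a h k (fun d => w d / 2) ∧
      cornerCube a h σ (k, z) (1 / 2) = dyadicCube a h (k + 1) w := by
  refine ⟨fun d => decide (w d % 2 = 1),
    fun d => if w d % 2 = 1 then 2 ^ k - 1 - w d / 2 else w d / 2, ?_, ?_⟩
  · ext x
    refine forall_congr' fun d => ?_
    dsimp only
    rw [cornerMap_eq hh x d]
    simp only [decide_eq_true_eq]
    split_ifs
    · push_cast
      constructor <;> rintro ⟨h1, h2⟩ <;> constructor <;> linarith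
    · rfl
  · ext x
    refine forall_congr' fun d => ?_
    dsimp only
    rw [cornerMap_eq hh x d, pow_succ]
    simp only [decide_eq_true_eq]
    have hw : (w d : ℝ) = 2 * ((w d / 2 : ℤ) : ℝ) + ((w d % 2 : ℤ) : ℝ) := by
      exact_mod_cast (Int.mul_ediv_add_emod (w d) 2).symm
    split_ifs with hd
    · rw [hd, Int.cast_one] at hw
      rw [hw]
      push_cast
      constructor <;> rintro ⟨h1, h2⟩ <;> constructor <;> linarith
    · rw [Int.emod_two_ne_one.1 hd, Int.cast_zero] at hw
      rw [hw]
      constructor <;> rintro ⟨h1, h2⟩ <;> constructor <;> linarith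

end dyadicCube

/-- A set of positive measure over which the integral of `f` is nonnegative. -/
def IsHeavy {X : Type*} [MeasurableSpace X] (μ : Measure X) (f : X → ℝ) (S : Set X) : Prop :=
  0 < μ S ∧ 0 ≤ ∫ x in S, f x ∂μ

theorem exists_disjoint_families_cover_cornerCube {n : ℕ} {a : Fin n → ℝ} {h : ℝ} (hh : 0 < h)
    (σ : Fin n → Bool) {μ : Measure (Fin n → ℝ)}
    (hμ : ∀ P : Set (Fin n → ℝ), IsCube n P → μ (frontier P) = 0)
    {Q : Set (Fin n → ℝ)} {f : (Fin n → ℝ) → ℝ} (hf : IntegrableOn f Q μ) :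
    ∃ G : Set (Fin n) → Set (Set (Fin n → ℝ)),
      (∀ s, (G s).Countable ∧ (G s).PairwiseDisjoint id) ∧
      (∀ s, ∀ q ∈ G s, IsCube n q ∧ q ⊆ Q ∧ 0 < μ q ∧ ∫ x in q, f x ∂μ = 0) ∧
      ∀ c : ℕ × (Fin n → ℤ), cornerCube a h σ c 1 ⊆ Q → ¬ IsHeavy μ f (cornerCube a h σ c 1) →
        IsHeavy μ f (cornerCube a h σ c (1 / 2)) →
        ∃ s, ∃ q ∈ G s, cornerCube a h σ c (1 / 2) ⊆ q := by
  set C : Set (ℕ × (Fin n → ℤ)) := {c | cornerCube a h σ c 1 ⊆ Q ∧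
    ¬ IsHeavy μ f (cornerCube a h σ c 1) ∧ IsHeavy μ f (cornerCube a h σ c (1 / 2))}
  have hex : ∀ c, ∃ t : ℝ, c ∈ C →
      1 / 2 ≤ t ∧ t < 1 ∧ ∫ x in cornerCube a h σ c t, f x ∂μ = 0 := by
    intro c
    by_cases hc : c ∈ C
    swap
    · exact ⟨0, fun h => (hc h).elim⟩
    obtain ⟨hcQ, hnot, hheavy⟩ := hc
    have hneg : ∫ x in cornerCube a h σ c 1, f x ∂μ < 0 := by
      by_contra! hge
      exact hnot ⟨hheavy.1.trans_le (measure_mono (cornerCube_mono (by norm_num))), hge⟩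
    obtain ⟨t, ht⟩ := exists_setIntegral_cornerCube_eq_zero hh hμ (hf.mono_set hcQ) hneg hheavy.2
    exact ⟨t, fun _ => ht⟩
  choose t ht using hex
  obtain ⟨S, hSC, hcov, col, hcol⟩ :=
    exists_cornerBox_selection C t fun c hc => ⟨(ht c hc).1, (ht c hc).2.1⟩
  refine ⟨fun s => (fun c => cornerCube a h σ c (t c)) '' {c | c ∈ S ∧ col c = s},
    fun s => ⟨(to_countable _).image _, ?_⟩, ?_, fun c hc1 hc2 hc3 => ?_⟩
  · rintro _ ⟨c, ⟨hc, hcs⟩, rfl⟩ _ ⟨c', ⟨hc', hcs'⟩, rfl⟩ hne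
    refine (hcol c hc c' hc' (fun h => hne (by rw [h])) (hcs.trans hcs'.symm)).preimage _
  · rintro s _ ⟨c, ⟨hc, -⟩, rfl⟩
    obtain ⟨h1, h2, h3⟩ := ht c (hSC hc)
    exact ⟨isCube_cornerCube hh (by linarith), (cornerCube_mono h2.le).trans (hSC hc).1,
      (hSC hc).2.2.1.trans_le (measure_mono (cornerCube_mono h1)), h3⟩
  · obtain ⟨c', hc', hsub⟩ := hcov c ⟨hc1, hc2, hc3⟩
    exact ⟨col c', _, ⟨c', ⟨hc', rfl⟩, rfl⟩, preimage_mono hsub⟩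

theorem tsum_measure_le_of_pairwiseDisjoint {X : Type*} [MeasurableSpace X] {μ : Measure X}
    {Q : Set X} (hfin : μ Q ≠ ∞) {g : X → ℝ} (hg : ∀ x, 0 ≤ g x) (hint : IntegrableOn g Q μ)
    {L : ℝ} (hL : 0 < L) {G : Set (Set X)} (hcount : G.Countable) (hdis : G.PairwiseDisjoint id)
    (hG : ∀ q ∈ G, MeasurableSet q ∧ q ⊆ Q ∧ ∫ x in q, g x ∂μ = L * μ.real q) :
    ∑' q : G, μ (q : Set X) ≤ ENNReal.ofReal ((∫ x in Q, g x ∂μ) / L) := by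
  rw [ENNReal.ofReal_div_of_pos hL, ENNReal.le_div_iff_mul_le (by simp [hL]) (by simp), mul_comm,
    ← ENNReal.tsum_mul_left, ← ofReal_setIntegral hg hint]
  calc ∑' q : G, ENNReal.ofReal L * μ (q : Set X)
      = ∑' q : G, ∫⁻ x in (q : Set X), ENNReal.ofReal (g x) ∂μ := by
        refine tsum_congr fun ⟨q, hq⟩ => ?_
        obtain ⟨-, h2, h3⟩ := hG q hq
        rw [ofReal_setIntegral hg (hint.mono_set h2), h3, ENNReal.ofReal_mul hL.le,
          ofReal_measureReal (measure_ne_top_of_subset h2 hfin)]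
    _ = ∫⁻ x in ⋃ q ∈ G, q, ENNReal.ofReal (g x) ∂μ :=
        (lintegral_biUnion hcount (fun q hq => (hG q hq).1) hdis _).symm
    _ ≤ ∫⁻ x in Q, ENNReal.ofReal (g x) ∂μ :=
        lintegral_mono_set (iUnion₂_subset fun q hq => (hG q hq).2.1)

/-- Besicovitch–Calderón–Zygmund decomposition: there exists a constant `B = B(n)`
(the Besicovitch constant, depending only on `n`) such that for any non-atomic Borel
measure `μ` on `ℝⁿ` with null cube boundaries, any cube `Q` with `0 < μ(Q) < ∞`,
any nonnegative `g ∈ L¹(Q,μ)` and any `L > 0` with `⨍_Q g dμ < L`, there is an at most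
countable family `F` of cubes contained in `Q` with `⨍_{Q_j} g dμ = L` for each member,
`g ≤ L` μ-a.e. on `Q \ ⋃ F`, and `F` splits into `B` subfamilies of pairwise disjoint
cubes; in particular `∑_j μ(Q_j) ≤ B · (∫_Q g dμ)/L`. -/
theorem besicovitch_calderon_zygmund (n : ℕ) :
    ∃ B : ℕ, 0 < B ∧
      ∀ (μ : Measure (Fin n → ℝ)), NoAtoms μ →
        (∀ P : Set (Fin n → ℝ), IsCube n P → μ (frontier P) = 0) →
        ∀ Q : Set (Fin n → ℝ), IsCube n Q → 0 < μ Q → μ Q < ⊤ →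
        ∀ g : (Fin n → ℝ) → ℝ, (∀ x, 0 ≤ g x) → IntegrableOn g Q μ →
        ∀ L : ℝ, 0 < L → (⨍ x in Q, g x ∂μ) < L →
        ∃ F : Set (Set (Fin n → ℝ)), F.Countable ∧
          (∀ q ∈ F, IsCube n q ∧ q ⊆ Q ∧ (⨍ x in q, g x ∂μ) = L) ∧
          (∀ᵐ x ∂μ.restrict (Q \ ⋃₀ F), g x ≤ L) ∧
          (∃ G : Fin B → Set (Set (Fin n → ℝ)),
            (⋃ k, G k) = F ∧ ∀ k, (G k).PairwiseDisjoint id) ∧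
          ∑' (q : F), μ (q : Set (Fin n → ℝ)) ≤
            (B : ℝ≥0∞) * ENNReal.ofReal ((∫ x in Q, g x ∂μ) / L) := by
  set e := Finite.equivFin ((Fin n → Bool) × Set (Fin n))
  refine ⟨Nat.card ((Fin n → Bool) × Set (Fin n)), Nat.card_pos, ?_⟩
  intro μ _ hμ Q hQ hQpos hQfin g hg hint L hL havg
  obtain ⟨a, h, hh, hQeq⟩ := hQ
  rw [← dyadicCube_zero hh] at hQeq
  subst hQeq
  set Q := dyadicCube a h 0 0
  have hcube : ∀ k z, IsCube n (dyadicCube a h k z) := fun k z => isCube_cornerCube hh one_pos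
  have hf : IntegrableOn (fun x => g x - L) Q μ := hint.sub (integrableOn_const hQfin.ne)
  have hfint : ∀ S ⊆ Q, ∫ x in S, (g x - L) ∂μ = (∫ x in S, g x ∂μ) - L * μ.real S := by
    intro S hS
    have : IntegrableOn (fun _ => L) S μ :=
      integrableOn_const (measure_ne_top_of_subset hS hQfin.ne)
    rw [integral_sub (hint.mono_set hS) this, setIntegral_const, smul_eq_mul, mul_comm L]
  have hroot : ¬ IsHeavy μ (fun x => g x - L) Q := by
    rintro ⟨-, h0⟩
    have hr : 0 < μ.real Q := ENNReal.toReal_pos hQpos.ne' hQfin.ne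
    rw [hfint Q subset_rfl] at h0
    rw [setAverage_eq, smul_eq_mul, inv_mul_lt_iff₀ hr] at havg
    linarith
  choose G hG1 hG2 hG3 using fun σ => exists_disjoint_families_cover_cornerCube hh σ hμ hf (a := a)
  set F := ⋃ k, G (e.symm k).1 (e.symm k).2
  have hF : ∀ q ∈ F, IsCube n q ∧ q ⊆ Q ∧ 0 < μ q ∧ ∫ x in q, g x ∂μ = L * μ.real q := by
    intro q hq
    obtain ⟨k, hk⟩ := mem_iUnion.1 hq
    obtain ⟨h1, h2, h3, h4⟩ := hG2 _ _ q hk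
    rw [hfint q h2] at h4
    exact ⟨h1, h2, h3, by linarith⟩
  have hFcount : F.Countable := countable_iUnion fun k => (hG1 _ _).1
  have hFmeas : ∀ q ∈ F, MeasurableSet q := by
    intro q hq
    obtain ⟨b, r, -, rfl⟩ := (hF q hq).1
    exact MeasurableSet.univ_pi fun _ => measurableSet_Icc
  refine ⟨F, hFcount, fun q hq => ?_, ?_, ⟨_, rfl, fun k => (hG1 _ _).2⟩, ?_⟩
  · obtain ⟨h1, h2, h3, h4⟩ := hF q hq
    refine ⟨h1, h2, ?_⟩
    have hr : 0 < μ.real q := ENNReal.toReal_pos h3.ne' (measure_ne_top_of_subset h2 hQfin.ne)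
    rw [setAverage_eq, h4, smul_eq_mul]
    field_simp
  · have hindex : ∀ x ∈ interior Q, ∀ k d,
        0 ≤ dyadicIndex a h k x d ∧ dyadicIndex a h k x d < 2 ^ k := by
      intro x hx k d
      have h1 := (interior_subset hx d).1
      have h2 := lt_of_mem_interior_cornerCube hh one_pos hx d
      simp only [pow_zero, one_mul, Pi.zero_apply, Int.cast_zero, zero_add] at h1 h2
      refine ⟨Int.floor_nonneg.2 (by positivity), Int.floor_lt.2 ?_⟩
      push_cast
      exact mul_lt_of_lt_one_right (by positivity) h2
    have hsub : ∀ x ∈ interior Q, ∀ k, dyadicCube a h k (dyadicIndex a h k x) ⊆ Q :=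
      fun x hx k => dyadicCube_subset (hindex x hx k)
    have hheavy : ∀ x ∈ interior Q \ ⋃₀ F, ∀ k,
        ¬ IsHeavy μ (fun x => g x - L) (dyadicCube a h k (dyadicIndex a h k x)) := by
      rintro x ⟨hx, hxF⟩ k
      induction k with
      | zero =>
        have h0 : dyadicIndex a h 0 x = 0 := by
          ext d
          have := hindex x hx 0 d
          simp only [pow_zero, Pi.zero_apply] at this ⊢
          omega
        rwa [h0]
      | succ k ih =>
        intro hbad
        obtain ⟨σ, z, hz1, hz2⟩ :=
          exists_cornerCube_eq_dyadicCube (a := a) hh k (dyadicIndex a h (k + 1) x)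
        simp only [dyadicIndex_succ_ediv_two] at hz1
        obtain ⟨s, q, hq, hsubq⟩ := hG3 σ (k, z) (hz1 ▸ hsub x hx k) (hz1 ▸ ih) (hz2 ▸ hbad)
        rw [hz2] at hsubq
        refine hxF ⟨q, mem_iUnion.2 ⟨e (σ, s), ?_⟩, hsubq (mem_dyadicCube_dyadicIndex x)⟩
        rwa [e.symm_apply_apply]
    have hae : ∀ᵐ x ∂μ.restrict (interior Q \ ⋃₀ F), g x ≤ L := by
      refine ae_le_of_setIntegral_dyadicCube_le hh hμ hQfin.ne hg hint hL
        (isOpen_interior.measurableSet.diff (MeasurableSet.sUnion hFcount hFmeas))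
        (sdiff_subset.trans interior_subset) (fun x hx => hsub x hx.1) fun x hx k => ?_
      by_contra! hgt
      have hPQ := hsub x hx.1 k
      refine hheavy x hx k ⟨?_, by rw [hfint _ hPQ]; linarith⟩
      rw [pos_iff_ne_zero]
      intro h0
      rw [Measure.restrict_eq_zero.2 h0, integral_zero_measure, measureReal_def, h0] at hgt
      simp at hgt
    have hEq : (Q \ ⋃₀ F : Set (Fin n → ℝ)) =ᵐ[μ] (interior Q \ ⋃₀ F : Set (Fin n → ℝ)) :=
      (interior_ae_eq_of_null_frontier (hμ Q (hcube 0 0))).symm.diff (ae_eq_refl _)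
    rwa [Measure.restrict_congr_set hEq]
  · calc ∑' q : F, μ (q : Set (Fin n → ℝ))
        ≤ ∑ k, ∑' q : G (e.symm k).1 (e.symm k).2, μ (q : Set (Fin n → ℝ)) :=
          ENNReal.tsum_iUnion_le _ _
      _ ≤ ∑ _k : Fin (Nat.card ((Fin n → Bool) × Set (Fin n))),
            ENNReal.ofReal ((∫ x in Q, g x ∂μ) / L) := by
          refine Finset.sum_le_sum fun k _ => ?_
          refine tsum_measure_le_of_pairwiseDisjoint hQfin.ne hg hint hL (hG1 _ _).1 (hG1 _ _).2
            fun q hq => ?_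
          have hqF : q ∈ F := mem_iUnion.2 ⟨k, hq⟩
          exact ⟨hFmeas q hqF, (hF q hqF).2.1, (hF q hqF).2.2.2⟩
      _ = _ := by simp
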